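/- For all complex numbers x, y, the pullback of the G₂ invariant polynomials under the Langlands involution τ (induced by rotation by π/2 on the real span of the roots) satisfies I₁(√3·x + (2/√3)·y, −2√3·x − √3·y) = I₁(x,y) and I₂(√3·x + (2/√3)·y, −2√3·x − √3·y) = −I₂(x,y) + (4/27)·I₁(x,y)³. -/

import Mathlib

noncomputable def I1 (x y : ℂ) : ℂ := 3*x^2 + 3*x*y + y^2

noncomputable def I2 (x y : ℂ) : ℂ :=
  4*x^6 + 12*x^5*y + 13*x^4*y^2 + 6*x^3*y^3 + x^2*y^4

/-- the pullback of the `G₂` invariant polynomials under the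
Langlands involution `τ` (rotation by `π/2`, sending
`α₁ ↦ (1/√3)(3α₁+2α₂)`, `α₂ ↦ −√3(2α₁+α₂)`) satisfies
`τ^*I₁ = I₁` and `τ^*I₂ = −I₂ + (4/27)I₁³`. -/
theorem g2_invariants_langlands (x y : ℂ) :
    I1 ((Real.sqrt 3 : ℂ) * x + (2 / (Real.sqrt 3 : ℂ)) * y)
       (-2 * (Real.sqrt 3 : ℂ) * x - (Real.sqrt 3 : ℂ) * y) = I1 x y ∧
    I2 ((Real.sqrt 3 : ℂ) * x + (2 / (Real.sqrt 3 : ℂ)) * y)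
       (-2 * (Real.sqrt 3 : ℂ) * x - (Real.sqrt 3 : ℂ) * y) =
      -(I2 x y) + (4/27) * (I1 x y)^3 := by
  have hs : (Real.sqrt 3 : ℂ) ^ 2 = 3 := by
    rw [← Complex.ofReal_pow, Real.sq_sqrt (by norm_num)]
    norm_num
  have hs0 : (Real.sqrt 3 : ℂ) ≠ 0 := by
    intro h
    norm_num [h] at hs
  have hdiv : 2 / (Real.sqrt 3 : ℂ) = (Real.sqrt 3 : ℂ) * (2 / 3) := by
    rw [div_eq_iff hs0]
    linear_combination -(2 / 3) * hs
  rw [hdiv]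
  generalize (Real.sqrt 3 : ℂ) = s at hs
  have hs6 : s ^ 6 = 27 := by
    rw [show s ^ 6 = (s ^ 2) ^ 3 by ring, hs]
    norm_num
  constructor
  · unfold I1
    linear_combination (x ^ 2 + x * y + y ^ 2 / 3) * hs
  · have hI2 : I2 (s * x + s * (2 / 3) * y) (-2 * s * x - s * y) =
        s ^ 6 * I2 (x + 2 / 3 * y) (-2 * x - y) := by
      unfold I2
      ring
    rw [hI2, hs6]
    unfold I1 I2
    ring
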